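/- (Existence of finite-part paths) Let (G, π, x) be a Riemann slice-domain over ℍ with distinguished point. Then for every q ∈ G there exist finitely many paths γ₁, ..., γ_m in G, each slice preserving (i.e., π ∘ γ_i has image in a single slice ℂ_{I_i}), such that γ₁(0) = x, γ_i(1) = γ_{i+1}(0) ∈ π⁻¹(ℝ) for 1 ≤ i ≤ m−1, and γ_m(1) = q. -/

import Mathlib

noncomputable section

abbrev Hq := Quaternion ℝ

/-- The sphere of imaginary units of the quaternions. -/
def SphereS : Set Hq := {q | q ^ 2 = -1}

/-- The identification of `ℂ` with the slice plane `ℂ_I = ℝ + ℝI`. -/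
def sliceEmb (I : Hq) : ℂ → Hq := fun z => (z.re : Hq) + (z.im : Hq) * I

/-- The slice complex plane `ℂ_I = ℝ + ℝI`. -/
def sliceC (I : Hq) : Set Hq := Set.range (sliceEmb I)

/-- The slice-topology on the quaternions: the quotient topology induced by the
canonical map from the disjoint union of the slices, i.e. the supremum of the
topologies coinduced by the parametrizations of the slices. -/
def sliceTopology : TopologicalSpace Hq :=
  ⨆ I ∈ SphereS, TopologicalSpace.coinduced (sliceEmb I) inferInstance

/-- The real line inside the quaternions. -/
def realLine : Set Hq := Set.range (fun x : ℝ => (x : Hq))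

/-- `g : ℂ → ℍ` (thought of as a function on the slice `ℂ_I`) is (left) holomorphic on
`U`: real differentiable with `∂ₓ g + I ∂_y g = 0`. -/
def SliceHolomorphicOn (I : Hq) (g : ℂ → Hq) (U : Set ℂ) : Prop :=
  ∀ z ∈ U, ∃ L : ℂ →L[ℝ] Hq, HasFDerivAt g L z ∧ L 1 + I * L Complex.I = 0

/-- A function on a slice-open set is slice regular if it is holomorphic on each slice. -/
def SliceRegular (f : Hq → Hq) (Ω : Set Hq) : Prop :=
  ∀ I ∈ SphereS, SliceHolomorphicOn I (f ∘ sliceEmb I) (sliceEmb I ⁻¹' Ω)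

/-- `K(m)` for `K ∈ 𝕊^N` (with `K 0 = 1` by convention) and `1 ≤ m ≤ 2^N`:
`∏_{i=N}^{1} (K_i K_{i-1})^{m_i}` where `(m_N … m_1)₂` is the binary expansion of `m-1`. -/
def zetaTerm (K : ℕ → Hq) (N m : ℕ) : Hq :=
  ((List.range N).reverse.map
    (fun j => (K (j + 1) * K j) ^ (if Nat.testBit (m - 1) j then 1 else 0))).prod

/-- The matrix `σ_N` (0-indexed): entry `(i,j)` is `(-1)^{N+(j+1)}` if
`(i+1)+(j+1) = 2^N + 1`, and `0` otherwise. -/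
def sigmaMat (N : ℕ) : Matrix (Fin (2 ^ N)) (Fin (2 ^ N)) ℝ :=
  Matrix.of fun i j =>
    if (i : ℕ) + (j : ℕ) = 2 ^ N - 1 then (-1 : ℝ) ^ (N + (j : ℕ) + 1) else 0

def QOrth (I J : Hq) : Prop := (I * star J).re = 0

/-- If the topology of `X` is final with respect to maps `f i : ℂ → X`, then a set in the source of
a local homeomorphism to `X` is open as soon as it is stable under paths lying over a single
`Set.range (f i)`. -/
theorem IsLocalHomeomorph.isOpen_of_joinedIn_stable {G X ι : Type*} [TopologicalSpace G]
    [tX : TopologicalSpace X] {f : ι → ℂ → X}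
    (hX : tX = ⨆ i, TopologicalSpace.coinduced (f i) inferInstance)
    {π : G → X} (hπ : IsLocalHomeomorph π) {A : Set G}
    (hA : ∀ i, ∀ y ∈ A, ∀ z, JoinedIn (π ⁻¹' Set.range (f i)) y z → z ∈ A) : IsOpen A := by
  have hf : ∀ i, Continuous (f i) := fun i => by
    rw [continuous_iff_coinduced_le, hX]
    exact le_iSup (fun i => TopologicalSpace.coinduced (f i) inferInstance) i
  have hopen : ∀ O : Set X, (∀ i, IsOpen (f i ⁻¹' O)) → IsOpen O := fun O hO => by
    rw [hX, isOpen_iSup_iff]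
    exact fun i => isOpen_coinduced.2 (hO i)
  rw [isOpen_iff_mem_nhds]
  intro y hy
  obtain ⟨e, hye, rfl⟩ := hπ y
  have hO : IsOpen (e.target ∩ e.symm ⁻¹' A) := by
    refine hopen _ fun i => Metric.isOpen_iff.2 ?_
    rintro z ⟨hz, hzA⟩
    obtain ⟨ε, hε, hball⟩ := Metric.isOpen_iff.1 (e.open_target.preimage (hf i)) z hz
    refine ⟨ε, hε, fun w hw => ⟨hball hw, hA i _ hzA _ ?_⟩⟩
    have hseg : JoinedIn (Metric.ball z ε) z w :=
      ((convex_ball z ε).isPathConnected ⟨z, Metric.mem_ball_self hε⟩).joinedIn _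
        (Metric.mem_ball_self hε) _ hw
    have hcont : ContinuousOn (fun u => e.symm (f i u)) (Metric.ball z ε) :=
      e.continuousOn_symm.comp (hf i).continuousOn hball
    refine (hseg.map_continuousOn hcont).mono ?_
    rintro _ ⟨u, hu, rfl⟩
    exact ⟨u, (e.right_inv (hball hu)).symm⟩
  filter_upwards [(e.continuousOn.isOpen_inter_preimage e.open_source hO).mem_nhds
    ⟨hye, e.map_source hye, by simpa [e.left_inv hye] using hy⟩] with w hw
  simpa [e.left_inv hw.1] using hw.2.2

/-- In the total space of a connected local homeomorphism to a space with the final topology of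
maps `f i : ℂ → X`, any two points are linked by finitely many paths, each lying over a single
`Set.range (f i)`. -/
theorem IsLocalHomeomorph.reflTransGen_joinedIn {G X ι : Type*} [TopologicalSpace G]
    [ConnectedSpace G] [tX : TopologicalSpace X] {f : ι → ℂ → X}
    (hX : tX = ⨆ i, TopologicalSpace.coinduced (f i) inferInstance)
    {π : G → X} (hπ : IsLocalHomeomorph π) (x q : G) :
    Relation.ReflTransGen (fun a b => ∃ i, JoinedIn (π ⁻¹' Set.range (f i)) a b) x q := by
  let A : Set G :=
    {y | Relation.ReflTransGen (fun a b => ∃ i, JoinedIn (π ⁻¹' Set.range (f i)) a b) x y}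
  have hopen : IsOpen A :=
    hπ.isOpen_of_joinedIn_stable hX fun i y hy z hyz => hy.tail ⟨i, hyz⟩
  have hclosed : IsClosed A :=
    ⟨hπ.isOpen_of_joinedIn_stable hX fun i y hy z hyz hz => hy (hz.tail ⟨i, hyz.symm⟩)⟩
  have huniv : A = Set.univ := IsClopen.eq_univ ⟨hclosed, hopen⟩ ⟨x, .refl⟩
  exact huniv.ge (Set.mem_univ q)

theorem sliceTopology_eq_iSup :
    sliceTopology = ⨆ I : SphereS, TopologicalSpace.coinduced (sliceEmb I) inferInstance :=
  iSup_subtype'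

theorem exists_mem_sphereS_mem_sliceC (p : Hq) : ∃ I ∈ SphereS, p ∈ sliceC I := by
  by_cases hp : p.im = 0
  · let I : Hq := ⟨0, 1, 0, 0⟩
    refine ⟨I, ?_, ⟨p.re, 0⟩, ?_⟩
    · change I ^ 2 = -1
      obtain ⟨hr, hi, hj, hk⟩ : I.re = 0 ∧ I.imI = 1 ∧ I.imJ = 0 ∧ I.imK = 0 :=
        ⟨rfl, rfl, rfl, rfl⟩
      rw [sq]
      apply Quaternion.ext <;> simp [Quaternion.re_mul, Quaternion.imI_mul, Quaternion.imJ_mul,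
        Quaternion.imK_mul, Quaternion.re_one, Quaternion.imI_one, Quaternion.imJ_one,
        Quaternion.imK_one, hr, hi, hj, hk]
    · have h := Quaternion.re_add_im p
      rw [hp, add_zero] at h
      rw [sliceEmb, Quaternion.coe_zero, zero_mul, add_zero, h]
  · have hn : ‖p.im‖ ≠ 0 := norm_ne_zero_iff.2 hp
    refine ⟨((‖p.im‖⁻¹ : ℝ) : Hq) * p.im, ?_, ⟨p.re, ‖p.im‖⟩, ?_⟩
    · have him : p.im * p.im = -((‖p.im‖ * ‖p.im‖ : ℝ) : Hq) := by
        rw [← Quaternion.normSq_eq_norm_mul_self, ← Quaternion.self_mul_star, Quaternion.star_im,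
          mul_neg, neg_neg]
      change (((‖p.im‖⁻¹ : ℝ) : Hq) * p.im) ^ 2 = -1
      rw [(Quaternion.coe_commute _ _).mul_pow, sq p.im, him, mul_neg,
        ← Quaternion.coe_pow, ← Quaternion.coe_mul, neg_inj, ← Quaternion.coe_one]
      congr 1
      field_simp
    · simp only [sliceEmb, ← mul_assoc, ← Quaternion.coe_mul, mul_inv_cancel₀ hn,
        Quaternion.coe_one, one_mul]
      exact Quaternion.re_add_im p

/-- If two slices meet at a non-real point, each contains the other. -/
theorem sliceC_subset_of_mem {I J p : Hq} (hI : p ∈ sliceC I) (hJ : p ∈ sliceC J)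
    (hp : p ∉ realLine) : sliceC J ⊆ sliceC I := by
  obtain ⟨z, hz⟩ := hI
  obtain ⟨w, hw⟩ := hJ
  have hd : w.im ≠ 0 := fun h => hp ⟨w.re, by simp [← hw, sliceEmb, h]⟩
  have h : (w.im : Hq) * J = ((z.re - w.re : ℝ) : Hq) + (z.im : Hq) * I := by
    have h' := hz.trans hw.symm
    simp only [sliceEmb] at h'
    rw [Quaternion.coe_sub, sub_add_eq_add_sub, h', add_sub_cancel_left]
  have hJI : J = (((z.re - w.re) / w.im : ℝ) : Hq) + ((z.im / w.im : ℝ) : Hq) * I := by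
    have h2 := congrArg (fun a => ((w.im⁻¹ : ℝ) : Hq) * a) h
    simp only [mul_add, ← mul_assoc, ← Quaternion.coe_mul, inv_mul_cancel₀ hd,
      Quaternion.coe_one, one_mul] at h2
    rw [h2, div_eq_inv_mul, div_eq_inv_mul]
  rintro _ ⟨v, rfl⟩
  refine ⟨⟨v.re + v.im * ((z.re - w.re) / w.im), v.im * (z.im / w.im)⟩, ?_⟩
  conv_rhs => rw [sliceEmb, hJI]
  simp only [sliceEmb, mul_add, ← mul_assoc, ← Quaternion.coe_mul, Quaternion.coe_add, add_assoc]

/-- A chain of slice preserving paths can be regrouped so that all its junctions lie above the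
reals. -/
theorem exists_reflTransGen_real_joinedIn {G : Type*} [TopologicalSpace G] {π : G → Hq} {x q : G}
    (h : Relation.ReflTransGen
      (fun a b => ∃ I : SphereS, JoinedIn (π ⁻¹' sliceC I) a b) x q) :
    ∃ p, Relation.ReflTransGen
      (fun a b => ∃ I ∈ SphereS, JoinedIn (π ⁻¹' sliceC I) a b ∧ π b ∈ realLine) x p ∧
      ∃ I ∈ SphereS, JoinedIn (π ⁻¹' sliceC I) p q := by
  induction h with
  | refl =>
    obtain ⟨I, hI, hx⟩ := exists_mem_sphereS_mem_sliceC (π x)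
    exact ⟨x, .refl, I, hI, JoinedIn.refl hx⟩
  | @tail b c _ hstep ih =>
    obtain ⟨p, hxp, I, hI, hpb⟩ := ih
    obtain ⟨J, hbc⟩ := hstep
    by_cases hb : π b ∈ realLine
    · exact ⟨b, hxp.tail ⟨I, hI, hpb, hb⟩, J, J.2, hbc⟩
    · exact ⟨p, hxp, I, hI, hpb.trans (hbc.mono
        (Set.preimage_mono (sliceC_subset_of_mem hpb.target_mem hbc.source_mem hb)))⟩

theorem JoinedIn.exists_continuousOn_Icc {G : Type*} [TopologicalSpace G] {S : Set G} {a b : G}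
    (h : JoinedIn S a b) :
    ∃ γ : ℝ → G, ContinuousOn γ (Set.Icc 0 1) ∧ (∀ t ∈ Set.Icc (0 : ℝ) 1, γ t ∈ S) ∧
      γ 0 = a ∧ γ 1 = b := by
  refine ⟨h.somePath.extend, h.somePath.continuous_extend.continuousOn, fun t ht => ?_,
    h.somePath.extend_zero, h.somePath.extend_one⟩
  rw [h.somePath.extend_apply ht]
  exact h.somePath_mem _

/-- Existence of finite-part paths: any point of a Riemann slice-domain can be reached
from the distinguished point by finitely many slice preserving paths, consecutive ones
meeting above the reals. -/
theorem exists_finitePart_path {G : Type*}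
    [TopologicalSpace G] [T2Space G] [ConnectedSpace G]
    (π : G → Hq) (hπ : @IsLocalHomeomorph G Hq _ sliceTopology π)
    (x q : G) :
    ∃ m : ℕ, 0 < m ∧ ∃ γ : ℕ → ℝ → G,
      (∀ i < m, ∃ I ∈ SphereS, ContinuousOn (γ i) (Set.Icc 0 1) ∧
        ∀ t ∈ Set.Icc (0 : ℝ) 1, π (γ i t) ∈ sliceC I) ∧
      γ 0 0 = x ∧ γ (m - 1) 1 = q ∧
      ∀ i, i + 1 < m → γ i 1 = γ (i + 1) 0 ∧ π (γ i 1) ∈ realLine := by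
  have hchain := @IsLocalHomeomorph.reflTransGen_joinedIn G Hq SphereS _ _ sliceTopology
    (fun I => sliceEmb I) sliceTopology_eq_iSup π hπ x q
  obtain ⟨p, hxp, I, hI, hpq⟩ := exists_reflTransGen_real_joinedIn hchain
  clear hchain
  induction hxp using Relation.ReflTransGen.head_induction_on with
  | refl =>
    obtain ⟨γ, hγ, hmem, h0, h1⟩ := hpq.exists_continuousOn_Icc
    exact ⟨1, one_pos, fun _ => γ, fun _ _ => ⟨I, hI, hγ, hmem⟩, h0, h1, fun i hi => by omega⟩
  | head hstep _ ih =>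
    obtain ⟨J, hJ, hab, hb⟩ := hstep
    obtain ⟨m, hm, γ, hγ, h0, h1, hjunction⟩ := ih
    obtain ⟨δ, hδ, hmem, hδ0, hδ1⟩ := hab.exists_continuousOn_Icc
    refine ⟨m + 1, m.succ_pos, fun i => Nat.casesOn i δ γ, ?_, hδ0, ?_, ?_⟩
    · rintro (_ | i) hi
      · exact ⟨J, hJ, hδ, hmem⟩
      · exact hγ i (by omega)
    · obtain ⟨n, rfl⟩ := Nat.exists_eq_succ_of_ne_zero hm.ne'
      exact h1
    · rintro (_ | i) hi
      · exact ⟨hδ1.trans h0.symm, by simpa [hδ1] using hb⟩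
      · exact hjunction i (by omega)
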